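/- arXiv:2507.08965 — 2 statements merged into one kernel-verified Lean document; each statement's English description precedes it below -/
import Mathlib

section
/- Let n ≥ 1 and let A be a real n×n matrix all of whose columns are zero except possibly the last one; write v : Fin n → ℝ for the last column of A (so A i j = 0 whenever j is not the last index, and A i (last) = v i). If the last entry v_last of v is nonzero, then the matrix exponential of A equals 1 + ((exp(v_last) − 1)/v_last) • A. -/
open scoped Nat in
/-- The exponential of an element `a` with `a * a = c • a` and `c ≠ 0`. -/
theorem exp_eq_one_add_smul_of_mul_self_eq_smul {R : Type*} [Ring R] [Algebra ℝ R]
    [TopologicalSpace R] [IsTopologicalRing R] [ContinuousSMul ℝ R] [T2Space R]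
    {a : R} {c : ℝ} (hc : c ≠ 0) (ha : a * a = c • a) :
    NormedSpace.exp a = 1 + ((Real.exp c - 1) / c) • a := by
  have hpow (k : ℕ) : a ^ (k + 1) = c ^ k • a := by
    induction k with
    | zero => simp
    | succ k ih => rw [pow_succ, ih, smul_mul_assoc, ha, smul_smul, ← pow_succ]
  have hexp : HasSum (fun k : ℕ => (k !⁻¹ : ℝ) * c ^ k) (Real.exp c) := by
    simpa [Real.exp_eq_exp_ℝ] using NormedSpace.exp_series_hasSum_exp' (𝕂 := ℝ) c
  have hone : HasSum (fun k : ℕ => if k = 0 then (1 : ℝ) else 0) 1 := hasSum_ite_eq 0 1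
  have hone' : HasSum (fun k : ℕ => if k = 0 then (1 : R) else 0) 1 := hasSum_ite_eq 0 1
  have hsum := hone'.add (((hexp.sub hone).div_const c).smul_const a)
  rw [NormedSpace.exp_eq_tsum ℝ, ← hsum.tsum_eq]
  refine tsum_congr fun k => ?_
  cases k with
  | zero => simp
  | succ k =>
    have hcoeff : ((k + 1)! : ℝ)⁻¹ * c ^ (k + 1) / c = ((k + 1)! : ℝ)⁻¹ * c ^ k := by
      rw [pow_succ, ← mul_assoc, mul_div_cancel_right₀ _ hc]
    simp [hpow, smul_smul, hcoeff]

/-- Let `n ≥ 1` and let `A` be a real `n × n` matrix all of whose columns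
are zero except possibly the last one; write `v : Fin n → ℝ` for the last column of `A`
(so `A i j = 0` whenever `j` is not the last index, and `A i last = v i`).  If the last
entry `v last` of `v` is nonzero, then the matrix exponential of `A` equals
`1 + ((exp (v last) - 1) / v last) • A`. -/
theorem matrix_exp_last_column (n : ℕ) (hn : 1 ≤ n)
    (A : Matrix (Fin n) (Fin n) ℝ) (v : Fin n → ℝ)
    (last : Fin n) (hlast : (last : ℕ) = n - 1)
    (hA : ∀ i j, j ≠ last → A i j = 0)
    (hv : ∀ i, A i last = v i)
    (hvlast : v last ≠ 0) :
    NormedSpace.exp A = 1 + ((Real.exp (v last) - 1) / v last) • A := by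
  refine exp_eq_one_add_smul_of_mul_self_eq_smul hvlast ?_
  ext i j
  rw [Matrix.mul_apply, Finset.sum_eq_single last (fun k _ hk => by rw [hA i k hk, zero_mul])
    (fun h => absurd (Finset.mem_univ last) h)]
  by_cases hj : j = last
  · subst hj
    simp [hv, mul_comm]
  · simp [hA _ j hj]
end

section
/- For all real numbers a, b, c, d and α, the matrix exponential of α • A, where A is the 4×4 real matrix with rows (0, a, b, 0), (0, −1, 0, c), (0, 0, −1, d), (0, 0, 0, −2), equals the 4×4 matrix with rows (1, a·(1 − e^{−α}), b·(1 − e^{−α}), ((a·c + b·d)/2)·(e^{α} − 1)²·e^{−2α}), (0, e^{−α}, 0, c·(e^{α} − 1)·e^{−2α}), (0, 0, e^{−α}, d·(e^{α} − 1)·e^{−2α}), (0, 0, 0, e^{−2α}). -/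
/-- A change of basis to eigenvectors of the matrix with rows `(0, a, b, 0)`, `(0, -1, 0, c)`,
`(0, 0, -1, d)`, `(0, 0, 0, -2)`: the columns are eigenvectors for `0, -1, -1, -2`. -/
noncomputable def eigenvectorUnit (a b c d : ℝ) : (Matrix (Fin 4) (Fin 4) ℝ)ˣ where
  val := !![1, -a, -b, (a * c + b * d) / 2; 0, 1, 0, -c; 0, 0, 1, -d; 0, 0, 0, 1]
  inv := !![1, a, b, (a * c + b * d) / 2; 0, 1, 0, c; 0, 0, 1, d; 0, 0, 0, 1]
  val_inv := by
    ext i j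
    fin_cases i <;> fin_cases j <;> simp [Matrix.mul_apply, Fin.sum_univ_four]
    ring
  inv_val := by
    ext i j
    fin_cases i <;> fin_cases j <;> simp [Matrix.mul_apply, Fin.sum_univ_four]
    ring

/-- Conjugating `diag(x, y, y, z)` by `eigenvectorUnit a b c d`. -/
theorem eigenvectorUnit_conj_diagonal (a b c d x y z : ℝ) :
    (eigenvectorUnit a b c d : Matrix (Fin 4) (Fin 4) ℝ) * Matrix.diagonal ![x, y, y, z] *
        ((eigenvectorUnit a b c d)⁻¹ : (Matrix (Fin 4) (Fin 4) ℝ)ˣ) =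
      !![x, a * (x - y), b * (x - y), (a * c + b * d) / 2 * (x - 2 * y + z);
         0, y, 0, c * (y - z);
         0, 0, y, d * (y - z);
         0, 0, 0, z] := by
  change !![1, -a, -b, (a * c + b * d) / 2; 0, 1, 0, -c; 0, 0, 1, -d; 0, 0, 0, 1] *
      Matrix.diagonal ![x, y, y, z] *
      !![1, a, b, (a * c + b * d) / 2; 0, 1, 0, c; 0, 0, 1, d; 0, 0, 0, 1] = _
  ext i j
  fin_cases i <;> fin_cases j <;>
    simp [Matrix.mul_apply, Fin.sum_univ_four, Matrix.vecMul_diagonal] <;> ring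

/-- For all real numbers `a, b, c, d` and `α`, the matrix exponential of
`α • A`, where `A` is the 4×4 real matrix with rows `(0, a, b, 0)`, `(0, -1, 0, c)`,
`(0, 0, -1, d)`, `(0, 0, 0, -2)`, equals the 4×4 matrix with rows
`(1, a(1 - e^{-α}), b(1 - e^{-α}), ((ac + bd)/2)(e^α - 1)² e^{-2α})`,
`(0, e^{-α}, 0, c(e^α - 1)e^{-2α})`, `(0, 0, e^{-α}, d(e^α - 1)e^{-2α})`,
`(0, 0, 0, e^{-2α})`. -/
theorem matrix_exp_four_by_four (a b c d α : ℝ) :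
    NormedSpace.exp
        (α • (!![0, a, b, 0;
                 0, -1, 0, c;
                 0, 0, -1, d;
                 0, 0, 0, -2] : Matrix (Fin 4) (Fin 4) ℝ)) =
      !![1, a * (1 - Real.exp (-α)), b * (1 - Real.exp (-α)),
           ((a * c + b * d) / 2) * (Real.exp α - 1) ^ 2 * Real.exp (-(2 * α));
         0, Real.exp (-α), 0, c * (Real.exp α - 1) * Real.exp (-(2 * α));
         0, 0, Real.exp (-α), d * (Real.exp α - 1) * Real.exp (-(2 * α));
         0, 0, 0, Real.exp (-(2 * α))] := by
  have hdiag := eigenvectorUnit_conj_diagonal a b c d 0 (-α) (-(2 * α))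
  have hexp : NormedSpace.exp ![0, -α, -α, -(2 * α)] =
      ![1, Real.exp (-α), Real.exp (-α), Real.exp (-(2 * α))] := by
    ext i
    rw [Pi.coe_exp, ← Real.exp_eq_exp_ℝ]
    fin_cases i <;> simp
  have hα : Real.exp α * Real.exp (-(2 * α)) = Real.exp (-α) := by
    rw [← Real.exp_add]
    ring_nf
  have hα' : Real.exp α * Real.exp (-α) = 1 := by
    rw [← Real.exp_add, add_neg_cancel, Real.exp_zero]
  calc
    _ = NormedSpace.exp (_ * _ * _) := by
      rw [hdiag]
      congr 1
      ext i j
      fin_cases i <;> fin_cases j <;> simp <;> ring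
    _ = _ := by
      rw [Matrix.exp_units_conj, Matrix.exp_diagonal, hexp, eigenvectorUnit_conj_diagonal]
      ext i j
      fin_cases i <;> fin_cases j <;> simp <;> grind
end
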